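/- Let Ψ: B_{3/2}(0) → [0,1] be defined by Ψ(x) = min(3/2 - |x|, 1), and let μ(x,dy) be a family of measures satisfying (K1) and (K2) with constant Λ and order α ∈ (α₀, 2). Then there exists c₂ = c₂(d, α₀, Λ) > 0 such that for every v ∈ L¹(B_{3/2}, Ψ(x)dx): ∫_{B_{3/2}} (v(x) - v_Ψ)² Ψ(x) dx ≤ c₂ ∬_{B_{3/2}×B_{3/2}} (v(x)-v(y))² min(Ψ(x), Ψ(y)) μ(x, dy) dx, where v_Ψ = (∫_{B_{3/2}} Ψ)^{-1} ∫_{B_{3/2}} v(x)Ψ(x) dx is the weighted mean. -/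

import Mathlib

open MeasureTheory

/-- Condition (K1) with order `α` and constant `Λ`. -/
def CondK1 (d : ℕ) (α Λ : ℝ)
    (μ : EuclideanSpace ℝ (Fin d) → Measure (EuclideanSpace ℝ (Fin d))) : Prop :=
  ∀ (x₀ : EuclideanSpace ℝ (Fin d)) (ρ : ℝ), 0 < ρ →
    ENNReal.ofReal (ρ ^ (-2 : ℝ)) *
        ∫⁻ y in Metric.closedBall x₀ ρ, ENNReal.ofReal (‖x₀ - y‖ ^ 2) ∂(μ x₀)
      + μ x₀ (Metric.closedBall x₀ ρ)ᶜ
      ≤ ENNReal.ofReal (Λ * ρ ^ (-α))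

/-- Condition (K2): comparability of energy forms on every ball, with constant `Λ`. -/
def CondK2 (d : ℕ) (α Λ : ℝ)
    (μ : EuclideanSpace ℝ (Fin d) → Measure (EuclideanSpace ℝ (Fin d))) : Prop :=
  ∀ (x₀ : EuclideanSpace ℝ (Fin d)) (ρ : ℝ), 0 < ρ →
    ∀ v : EuclideanSpace ℝ (Fin d) → ℝ, Measurable v →
      ENNReal.ofReal Λ⁻¹ *
          ∫⁻ x in Metric.ball x₀ ρ, ∫⁻ y in Metric.ball x₀ ρ,
            ENNReal.ofReal ((v x - v y) ^ 2) ∂(μ x)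
        ≤ ENNReal.ofReal (2 - α) *
            ∫⁻ x in Metric.ball x₀ ρ, ∫⁻ y in Metric.ball x₀ ρ,
              ENNReal.ofReal ((v x - v y) ^ 2 * ‖x - y‖ ^ (-(d : ℝ) - α)) ∧
      ENNReal.ofReal (2 - α) *
          ∫⁻ x in Metric.ball x₀ ρ, ∫⁻ y in Metric.ball x₀ ρ,
            ENNReal.ofReal ((v x - v y) ^ 2 * ‖x - y‖ ^ (-(d : ℝ) - α))
        ≤ ENNReal.ofReal Λ *
            ∫⁻ x in Metric.ball x₀ ρ, ∫⁻ y in Metric.ball x₀ ρ,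
              ENNReal.ofReal ((v x - v y) ^ 2) ∂(μ x)

/-- The tent-shaped weight `Ψ(x) = min(3/2 - |x|, 1)`. -/
noncomputable def tentWeight (d : ℕ) (x : EuclideanSpace ℝ (Fin d)) : ℝ :=
  min (3 / 2 - ‖x‖) 1

open scoped ENNReal

namespace WP

lemma set_pair {X : Type*} [MeasurableSpace X] (ν : Measure X) (μ : X → Measure X) {B : Set X}
    (hB : MeasurableSet B) (f : X → X → ℝ≥0∞) :
    ∫⁻ x in B, ∫⁻ y in B, f x y ∂(μ x) ∂ν =
      ∫⁻ x, ∫⁻ y, (B ×ˢ B).indicator (fun p => f p.1 p.2) (x, y) ∂(μ x) ∂ν := by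
  rw [← lintegral_indicator hB]
  congr 1
  ext x
  by_cases hx : x ∈ B
  · rw [Set.indicator_of_mem hx, ← lintegral_indicator hB]
    congr 1
    ext y
    by_cases hy : y ∈ B
    · simp [hx, hy]
    · simp [hy]
  · rw [Set.indicator_of_notMem hx]
    simp [hx]

lemma tsum_lintegral_le {X : Type*} [MeasurableSpace X] (ν : Measure X) (f : ℕ → X → ℝ≥0∞) :
    ∑' k, ∫⁻ x, f k x ∂ν ≤ ∫⁻ x, ∑' k, f k x ∂ν := by
  apply ENNReal.tsum_le_of_sum_range_le
  intro n
  have h : ∑ i ∈ Finset.range n, ∫⁻ x, f i x ∂ν ≤ ∫⁻ x, ∑ i ∈ Finset.range n, f i x ∂ν := by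
    induction n with
    | zero => simp
    | succ n ih =>
      simp_rw [Finset.sum_range_succ]
      exact (add_le_add_left ih _).trans (le_lintegral_add _ _)
  exact h.trans (lintegral_mono fun x => ENNReal.sum_le_tsum _)

/-- dyadic layer-cake sum -/
noncomputable def S (u : ℝ) : ℝ≥0∞ :=
  ∑' k : ℕ, if (1 / 2 : ℝ) ^ (k + 1) < u then ENNReal.ofReal ((1 / 2 : ℝ) ^ (k + 1)) else 0

lemma S_eq (u : ℝ) (hu : 0 < u) : ∃ k : ℕ, S u = ENNReal.ofReal ((1 / 2 : ℝ) ^ k) ∧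
    (1 / 2 : ℝ) ^ (k + 1) < u ∧ (k = 0 ∨ u ≤ (1 / 2 : ℝ) ^ k) := by
  classical
  have hex : ∃ k : ℕ, (1 / 2 : ℝ) ^ (k + 1) < u := by
    obtain ⟨n, hn⟩ := exists_pow_lt_of_lt_one hu (by norm_num : (1 / 2 : ℝ) < 1)
    exact ⟨n, lt_of_le_of_lt (pow_le_pow_of_le_one (by norm_num) (by norm_num) (Nat.le_succ n)) hn⟩
  refine ⟨Nat.find hex, ?_, Nat.find_spec hex, ?_⟩
  · set k := Nat.find hex with hk
    unfold S
    rw [← Summable.sum_add_tsum_nat_add' (k := k) ENNReal.summable]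
    have h0 : ∑ i ∈ Finset.range k, (if (1 / 2 : ℝ) ^ (i + 1) < u then
        ENNReal.ofReal ((1 / 2 : ℝ) ^ (i + 1)) else 0) = 0 := by
      apply Finset.sum_eq_zero
      intro i hi
      rw [if_neg (Nat.find_min hex (Finset.mem_range.1 hi))]
    rw [h0, zero_add]
    have h1 : ∀ i : ℕ, (if (1 / 2 : ℝ) ^ (i + k + 1) < u then
        ENNReal.ofReal ((1 / 2 : ℝ) ^ (i + k + 1)) else 0) =
        ENNReal.ofReal ((1 / 2 : ℝ) ^ k * ((1 / 2) / 2 ^ i)) := by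
      intro i
      rw [if_pos]
      · congr 1
        rw [pow_add, pow_add, one_div_pow, one_div_pow]
        ring
      · exact lt_of_le_of_lt (pow_le_pow_of_le_one (by norm_num) (by norm_num) (by omega))
          (Nat.find_spec hex)
    simp_rw [h1]
    have hs := (hasSum_geometric_two' (1 : ℝ)).mul_left ((1 / 2 : ℝ) ^ k)
    rw [← ENNReal.ofReal_tsum_of_nonneg (fun i => by positivity) hs.summable, hs.tsum_eq, mul_one]
  · rcases Nat.eq_zero_or_pos (Nat.find hex) with h | h
    · exact Or.inl h
    · right
      have := Nat.find_min hex (Nat.sub_lt h one_pos)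
      rw [show Nat.find hex - 1 + 1 = Nat.find hex by omega] at this
      exact not_lt.1 this

lemma le_S (u : ℝ) : ENNReal.ofReal (min u 1) ≤ S u := by
  rcases le_or_gt u 0 with hu | hu
  · rw [ENNReal.ofReal_of_nonpos (min_le_of_left_le hu)]; exact zero_le
  · obtain ⟨k, hk, _, h⟩ := S_eq u hu
    rw [hk]
    apply ENNReal.ofReal_le_ofReal
    rcases h with h | h
    · subst h; simp
    · exact min_le_of_left_le h

lemma S_le (u : ℝ) : S u ≤ ENNReal.ofReal 2 * ENNReal.ofReal (min u 1) := by
  rcases le_or_gt u 0 with hu | hu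
  · unfold S
    rw [ENNReal.tsum_eq_zero.2]
    · exact zero_le
    · intro k
      rw [if_neg]
      have : (0 : ℝ) < (1 / 2) ^ (k + 1) := by positivity
      linarith
  · obtain ⟨k, hk, h1, _⟩ := S_eq u hu
    rw [hk, ← ENNReal.ofReal_mul (by norm_num)]
    apply ENNReal.ofReal_le_ofReal
    have h2 : (1 / 2 : ℝ) ^ (k + 1) ≤ 1 := pow_le_one₀ (by norm_num) (by norm_num)
    have : (1 / 2 : ℝ) ^ (k + 1) ≤ min u 1 := le_min h1.le h2
    rw [pow_succ] at this
    linarith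

lemma one_sub_le (s : ℝ) (hs : 0 < s) : 1 - (2 : ℝ) ^ (-s) ≤ s := by
  have h := Real.add_one_le_exp (Real.log 2 * (-s))
  rw [Real.rpow_def_of_pos (by norm_num)]
  have := Real.log_two_lt_d9
  nlinarith

section core
variable {d : ℕ}

local notation "𝔼" => EuclideanSpace ℝ (Fin d)

/-- pair energy density -/
noncomputable def gf (B : Set 𝔼) (v : 𝔼 → ℝ) (x y : 𝔼) : ℝ≥0∞ :=
  (B ×ˢ B).indicator (fun p : 𝔼 × 𝔼 => ENNReal.ofReal ((v p.1 - v p.2) ^ 2)) (x, y)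

lemma gf_meas {B : Set 𝔼} (hB : MeasurableSet B) {v : 𝔼 → ℝ} (hv : Measurable v) :
    Measurable (fun p : 𝔼 × 𝔼 => gf B v p.1 p.2) := by
  unfold gf
  apply Measurable.indicator _ (hB.prod hB)
  fun_prop

/-- translated energy -/
noncomputable def G (B : Set 𝔼) (v : 𝔼 → ℝ) (h : 𝔼) : ℝ≥0∞ := ∫⁻ x, gf B v x (x + h)

lemma G_meas {B : Set 𝔼} (hB : MeasurableSet B) {v : 𝔼 → ℝ} (hv : Measurable v) :
    Measurable (G B v) := by
  unfold G
  apply Measurable.lintegral_prod_right' (f := fun p : 𝔼 × 𝔼 => gf B v p.2 (p.2 + p.1))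
  exact (gf_meas hB hv).comp (by fun_prop : Measurable fun p : 𝔼 × 𝔼 => (p.2, p.2 + p.1))

lemma gf_tri {B : Set 𝔼} (hB : Convex ℝ B) (v : 𝔼 → ℝ) (x h : 𝔼) :
    gf B v x (x + (2 : ℝ) • h) ≤ 2 * gf B v x (x + h) + 2 * gf B v (x + h) (x + h + h) := by
  have e : x + (2 : ℝ) • h = x + h + h := by rw [two_smul, add_assoc]
  rw [e]
  by_cases hx : x ∈ B ∧ x + h + h ∈ B
  · have hm : x + h ∈ B := by
      have := hB hx.1 hx.2 (a := 1 / 2) (b := 1 / 2) (by norm_num) (by norm_num) (by norm_num)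
      convert this using 1
      module
    simp only [gf, Set.indicator, Set.mem_prod, hx.1, hx.2, hm, and_self, if_true]
    have e2 : (2 : ℝ≥0∞) = ENNReal.ofReal 2 := by simp
    simp only [e2]
    rw [← ENNReal.ofReal_mul (by norm_num),
      ← ENNReal.ofReal_mul (by norm_num), ← ENNReal.ofReal_add (by positivity) (by positivity)]
    apply ENNReal.ofReal_le_ofReal
    nlinarith [sq_nonneg ((v x - v (x + h)) - (v (x + h) - v (x + h + h)))]
  · have : gf B v x (x + h + h) = 0 := by
      unfold gf
      apply Set.indicator_of_notMem
      simpa [Set.mem_prod] using hx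
    rw [this]; exact zero_le

lemma G_two {B : Set 𝔼} (hB : Convex ℝ B) (hBm : MeasurableSet B) {v : 𝔼 → ℝ}
    (hv : Measurable v) (h : 𝔼) : G B v ((2 : ℝ) • h) ≤ 4 * G B v h := by
  have m1 : Measurable fun x => gf B v x (x + h) :=
    (gf_meas hBm hv).comp (by fun_prop : Measurable fun x : 𝔼 => (x, x + h))
  have m2 : Measurable fun x => gf B v (x + h) (x + h + h) :=
    (gf_meas hBm hv).comp (by fun_prop : Measurable fun x : 𝔼 => (x + h, x + h + h))
  calc G B v ((2 : ℝ) • h)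
      ≤ ∫⁻ x, (2 * gf B v x (x + h) + 2 * gf B v (x + h) (x + h + h)) :=
        lintegral_mono fun x => gf_tri hB v x h
    _ = 2 * G B v h + 2 * ∫⁻ x, gf B v (x + h) (x + h + h) := by
        rw [lintegral_add_left (m1.const_mul _), lintegral_const_mul _ m1,
          lintegral_const_mul _ m2]; rfl
    _ = 2 * G B v h + 2 * G B v h := by
        rw [lintegral_add_right_eq_self (fun x => gf B v x (x + h)) h]; rfl
    _ = 4 * G B v h := by ring

lemma energy_eq {B : Set 𝔼} (hBm : MeasurableSet B) {v : 𝔼 → ℝ}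
    (hv : Measurable v) (k : 𝔼 → ℝ) (hk : Measurable k) :
    ∫⁻ x in B, ∫⁻ y in B, ENNReal.ofReal ((v x - v y) ^ 2 * k (y - x)) =
      ∫⁻ h, G B v h * ENNReal.ofReal (k h) := by
  rw [set_pair volume (fun _ => volume) hBm]
  have h1 : ∀ x y : 𝔼, (B ×ˢ B).indicator
      (fun p : 𝔼 × 𝔼 => ENNReal.ofReal ((v p.1 - v p.2) ^ 2 * k (p.2 - p.1))) (x, y) =
      gf B v x y * ENNReal.ofReal (k (y - x)) := by
    intro x y
    unfold gf
    by_cases h : (x, y) ∈ B ×ˢ B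
    · rw [Set.indicator_of_mem h, Set.indicator_of_mem h, ENNReal.ofReal_mul (sq_nonneg _)]
    · rw [Set.indicator_of_notMem h, Set.indicator_of_notMem h, zero_mul]
  simp_rw [h1]
  have h2 : ∀ x : 𝔼, ∫⁻ y, gf B v x y * ENNReal.ofReal (k (y - x)) =
      ∫⁻ h, gf B v x (x + h) * ENNReal.ofReal (k h) := by
    intro x
    rw [← lintegral_add_left_eq_self _ x]
    simp
  simp_rw [h2]
  rw [lintegral_lintegral_swap]
  · congr 1
    ext h
    rw [lintegral_mul_const]
    · rfl
    · exact (gf_meas hBm hv).comp (by fun_prop : Measurable fun x : 𝔼 => (x, x + h))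
  · apply Measurable.aemeasurable
    apply Measurable.mul
    · exact (gf_meas hBm hv).comp
        (by fun_prop : Measurable fun p : 𝔼 × 𝔼 => (p.1, p.1 + p.2))
    · fun_prop

lemma scale (f : 𝔼 → ℝ≥0∞) (hf : Measurable f) :
    ∫⁻ h, f ((2 : ℝ) • h) = ENNReal.ofReal ((2 : ℝ) ^ (-(d : ℝ))) * ∫⁻ h, f h := by
  rw [← lintegral_map hf (by fun_prop : Measurable fun h : 𝔼 => (2 : ℝ) • h),
    Measure.map_addHaar_smul _ (by norm_num : (2 : ℝ) ≠ 0), lintegral_smul_measure]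
  congr 2
  rw [finrank_euclideanSpace_fin, Real.rpow_neg (by norm_num), Real.rpow_natCast,
    abs_of_pos (by positivity)]

lemma G_zero {B : Set 𝔼} (v : 𝔼 → ℝ) : G B v 0 = 0 := by
  have : ∀ x, gf B v x (x + 0) = 0 := by
    intro x
    unfold gf
    simp [Set.indicator]
  unfold G
  simp_rw [this]
  simp

lemma G_far {r : ℝ} (hr : r ≤ 3 / 2) (v : 𝔼 → ℝ) (h : 𝔼) (hh : 3 ≤ ‖h‖) :
    G (Metric.ball 0 r) v h = 0 := by
  have : ∀ x, gf (Metric.ball 0 r) v x (x + h) = 0 := by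
    intro x
    unfold gf
    apply Set.indicator_of_notMem
    rintro ⟨h1, h2⟩
    simp only [Metric.mem_ball, dist_zero_right] at h1 h2
    have := norm_sub_le (x + h) x
    rw [add_sub_cancel_left] at this
    linarith
  unfold G
  simp_rw [this]
  simp

lemma robust {r : ℝ} (hr : r ≤ 3 / 2) {α : ℝ} (h0 : 0 < α) (h2 : α < 2) (hd : 1 ≤ d)
    {v : 𝔼 → ℝ} (hv : Measurable v) :
    ENNReal.ofReal ((3 : ℝ) ^ (-(d : ℝ) - 2) / 2) *
      ∫⁻ x in Metric.ball (0 : 𝔼) r, ∫⁻ y in Metric.ball (0 : 𝔼) r,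
        ENNReal.ofReal ((v x - v y) ^ 2) ≤
    ENNReal.ofReal (2 - α) *
      ∫⁻ x in Metric.ball (0 : 𝔼) r, ∫⁻ y in Metric.ball (0 : 𝔼) r,
        ENNReal.ofReal ((v x - v y) ^ 2 * ‖x - y‖ ^ (-(d : ℝ) - α)) := by
  have hB : MeasurableSet (Metric.ball (0 : 𝔼) r) := measurableSet_ball
  have hC : Convex ℝ (Metric.ball (0 : 𝔼) r) := convex_ball _ _
  set l : ℝ := (3 : ℝ) ^ (-(d : ℝ) - 2) / 2 with hl
  have hlpos : 0 < l := by positivity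
  set g := G (Metric.ball (0 : 𝔼) r) v with hg
  have gm : Measurable g := G_meas hB hv
  have e1 := energy_eq hB hv (fun _ => 1) measurable_const
  have e2 := energy_eq hB hv (fun h => ‖h‖ ^ (-(d : ℝ) - α)) (by fun_prop)
  simp only [mul_one, ENNReal.ofReal_one] at e1
  have e2' : ∫⁻ x in Metric.ball (0 : 𝔼) r, ∫⁻ y in Metric.ball (0 : 𝔼) r,
        ENNReal.ofReal ((v x - v y) ^ 2 * ‖x - y‖ ^ (-(d : ℝ) - α)) =
        ∫⁻ h, g h * ENNReal.ofReal (‖h‖ ^ (-(d : ℝ) - α)) := by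
    rw [← e2]
    congr 1
    ext x
    congr 1
    ext y
    rw [norm_sub_rev]
  rw [e1, e2']
  set w : 𝔼 → ℝ≥0∞ := fun h => ENNReal.ofReal (‖h‖ ^ (-(d : ℝ) - α) - l) with hw
  have wm : Measurable w := by fun_prop
  set J := ∫⁻ h, g h * w h with hJ
  have hJle : J ≤ ∫⁻ h, g h * ENNReal.ofReal (‖h‖ ^ (-(d : ℝ) - α)) := by
    apply lintegral_mono
    intro h
    dsimp only [w]
    gcongr
    linarith
  set p : ℝ := (2 : ℝ) ^ ((d : ℝ) + α) with hp
  have hd' : (1 : ℝ) ≤ d := by exact_mod_cast hd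
  have hp2 : 2 ≤ p := by
    calc (2 : ℝ) = 2 ^ (1 : ℝ) := by simp
      _ ≤ p := Real.rpow_le_rpow_of_exponent_le (by norm_num) (by linarith)
  -- pointwise inequality
  have key : ∀ h, ENNReal.ofReal l * g h + ENNReal.ofReal p * (g h * w ((2 : ℝ) • h))
      ≤ g h * w h := by
    intro h
    by_cases hz : h = 0
    · subst hz; rw [hg, G_zero]; simp
    by_cases hf : 3 ≤ ‖h‖
    · rw [hg, G_far hr v h hf]; simp
    have hpos : 0 < ‖h‖ := norm_pos_iff.2 hz
    set t := ‖h‖ ^ (-(d : ℝ) - α) with ht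
    have ht2 : 2 * l ≤ t := by
      have a1 : (3 : ℝ) ^ (-(d : ℝ) - α) ≤ t :=
        Real.rpow_le_rpow_of_nonpos hpos (by linarith) (by linarith)
      have a2 : (3 : ℝ) ^ (-(d : ℝ) - 2) ≤ (3 : ℝ) ^ (-(d : ℝ) - α) :=
        Real.rpow_le_rpow_of_exponent_le (by norm_num) (by linarith)
      rw [hl]; linarith
    have hw2 : ENNReal.ofReal p * w ((2 : ℝ) • h) = ENNReal.ofReal (t - p * l) := by
      dsimp only [w]
      rw [← ENNReal.ofReal_mul (by linarith), norm_smul, Real.norm_eq_abs, abs_of_pos two_pos,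
        Real.mul_rpow (by norm_num) hpos.le, ← ht, mul_sub, ← mul_assoc, hp,
        ← Real.rpow_add (by norm_num)]
      simp
    have : ENNReal.ofReal l + ENNReal.ofReal (t - p * l) ≤ w h := by
      dsimp only [w]
      rw [← ht]
      rcases le_total (t - p * l) 0 with hc | hc
      · rw [ENNReal.ofReal_of_nonpos hc, add_zero]
        exact ENNReal.ofReal_le_ofReal (by linarith)
      · rw [← ENNReal.ofReal_add hlpos.le hc]
        exact ENNReal.ofReal_le_ofReal (by nlinarith)
    calc _ = g h * (ENNReal.ofReal l + ENNReal.ofReal p * w ((2 : ℝ) • h)) := by ring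
      _ ≤ _ := by rw [hw2]; gcongr
  have key2 : ENNReal.ofReal l * (∫⁻ h, g h) + ENNReal.ofReal ((2 : ℝ) ^ (-(2 - α))) * J ≤ J := by
    calc _ ≤ ∫⁻ h, (ENNReal.ofReal l * g h + ENNReal.ofReal p * (g h * w ((2 : ℝ) • h))) := by
          rw [lintegral_add_left (gm.const_mul _), lintegral_const_mul _ gm,
            lintegral_const_mul _ (by fun_prop)]
          refine add_le_add_right ?_ _
          have s := scale (fun h => g h * w h) (by fun_prop)
          have s2 : ∫⁻ h, g ((2 : ℝ) • h) * w ((2 : ℝ) • h) ≤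
              4 * ∫⁻ h, g h * w ((2 : ℝ) • h) := by
            rw [← lintegral_const_mul _ (by fun_prop)]
            apply lintegral_mono
            intro h
            dsimp only
            rw [← mul_assoc]
            gcongr
            exact G_two hC hB hv h
          rw [s] at s2
          calc ENNReal.ofReal ((2 : ℝ) ^ (-(2 - α))) * J
              = ENNReal.ofReal (p / 4) * (ENNReal.ofReal ((2 : ℝ) ^ (-(d : ℝ))) * J) := by
                rw [← mul_assoc, ← ENNReal.ofReal_mul (by positivity)]
                congr 2
                rw [hp, show (4 : ℝ) = 2 ^ (2 : ℝ) by norm_num, ← Real.rpow_sub (by norm_num),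
                  ← Real.rpow_add (by norm_num)]
                congr 1
                ring
            _ ≤ ENNReal.ofReal (p / 4) * (4 * ∫⁻ h, g h * w ((2 : ℝ) • h)) := by gcongr
            _ = ENNReal.ofReal p * ∫⁻ h, g h * w ((2 : ℝ) • h) := by
                rw [← mul_assoc, show (4 : ℝ≥0∞) = ENNReal.ofReal 4 by simp,
                  ← ENNReal.ofReal_mul (by positivity)]
                congr 2
                ring
      _ ≤ J := lintegral_mono key
  refine le_trans ?_ (mul_le_mul_right hJle _)
  have h2' : 0 < ENNReal.ofReal (2 - α) := ENNReal.ofReal_pos.2 (by linarith)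
  by_cases hJt : J = ∞
  · rw [hJt, ENNReal.mul_top h2'.ne']; exact le_top
  · have hq : ENNReal.ofReal ((2 : ℝ) ^ (-(2 - α))) * J ≠ ∞ :=
      ENNReal.mul_ne_top ENNReal.ofReal_ne_top hJt
    have : J ≤ ENNReal.ofReal (2 - α) * J + ENNReal.ofReal ((2 : ℝ) ^ (-(2 - α))) * J := by
      rw [← add_mul, ← ENNReal.ofReal_add (by linarith) (by positivity)]
      calc J = ENNReal.ofReal 1 * J := by simp
        _ ≤ _ := by
          gcongr
          linarith [one_sub_le (2 - α) (by linarith)]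
    exact (ENNReal.add_le_add_iff_right hq).1 (key2.trans this)

end core
end WP

namespace WP

lemma ofReal_integral_le {X : Type*} [MeasurableSpace X] {ν : Measure X} {f : X → ℝ}
    (hf : Integrable f ν) : ENNReal.ofReal (∫ x, f x ∂ν) ≤ ∫⁻ x, ENNReal.ofReal (f x) ∂ν := by
  calc ENNReal.ofReal (∫ x, f x ∂ν) ≤ ENNReal.ofReal (∫ x, max (f x) 0 ∂ν) := by
        apply ENNReal.ofReal_le_ofReal
        exact integral_mono hf hf.pos_part fun x => le_max_left _ _
    _ = ∫⁻ x, ENNReal.ofReal (max (f x) 0) ∂ν :=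
        ofReal_integral_eq_lintegral_ofReal hf.pos_part
          (Filter.Eventually.of_forall fun x => le_max_right _ _)
    _ = _ := by simp

lemma jensen {X : Type*} [MeasurableSpace X] {ν : Measure X} {v Ψ : X → ℝ}
    (hΨ : Integrable Ψ ν) (h0 : ∀ᵐ x ∂ν, 0 ≤ Ψ x) (hM : 0 < ∫ x, Ψ x ∂ν)
    (hv : Integrable (fun x => v x * Ψ x) ν) (a : ℝ) :
    ENNReal.ofReal ((a - (∫ x, Ψ x ∂ν)⁻¹ * ∫ x, v x * Ψ x ∂ν) ^ 2) ≤
      ENNReal.ofReal (∫ x, Ψ x ∂ν)⁻¹ * ∫⁻ y, ENNReal.ofReal ((a - v y) ^ 2 * Ψ y) ∂ν := by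
  set M := ∫ x, Ψ x ∂ν with hMdef
  set V := ∫ x, v x * Ψ x ∂ν with hV
  set D := a - M⁻¹ * V with hD
  have hi1 : Integrable (fun y => (2 * D * a - D ^ 2) * Ψ y) ν := hΨ.const_mul _
  have hi2 : Integrable (fun y => (2 * D) * (v y * Ψ y)) ν := hv.const_mul _
  have hIval : ∫ y, ((2 * D * a - D ^ 2) * Ψ y - (2 * D) * (v y * Ψ y)) ∂ν = M * D ^ 2 := by
    rw [integral_sub hi1 hi2, integral_const_mul, integral_const_mul, ← hMdef, ← hV]
    have : V = M * (a - D) := by rw [hD]; field_simp; ring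
    rw [this]; ring
  have h1 : ENNReal.ofReal (M * D ^ 2) ≤ ∫⁻ y, ENNReal.ofReal ((a - v y) ^ 2 * Ψ y) ∂ν := by
    rw [← hIval]
    refine (ofReal_integral_le (hi1.sub hi2)).trans ?_
    apply lintegral_mono_ae
    filter_upwards [h0] with y hy
    apply ENNReal.ofReal_le_ofReal
    simp only [Pi.sub_apply]
    nlinarith [mul_nonneg (sq_nonneg (a - v y - D)) hy]
  calc ENNReal.ofReal (D ^ 2) = ENNReal.ofReal M⁻¹ * ENNReal.ofReal (M * D ^ 2) := by
        rw [← ENNReal.ofReal_mul (by positivity)]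
        congr 1
        field_simp
    _ ≤ _ := by gcongr

section main
variable {d : ℕ}

local notation "𝔼" => EuclideanSpace ℝ (Fin d)
local notation "𝔹" => Metric.ball (0 : EuclideanSpace ℝ (Fin d)) (3 / 2)

lemma tent_cont : Continuous (tentWeight d) := by
  unfold tentWeight; fun_prop

lemma tent_pos {x : 𝔼} (hx : x ∈ 𝔹) : 0 < tentWeight d x := by
  rw [Metric.mem_ball, dist_zero_right] at hx
  unfold tentWeight
  exact lt_min (by linarith) one_pos

lemma tent_int : IntegrableOn (tentWeight d) 𝔹 :=
  (tent_cont.continuousOn.integrableOn_compact (isCompact_closedBall (0 : 𝔼) (3 / 2))).mono_set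
    Metric.ball_subset_closedBall

lemma tent_mass : 0 < ∫ y in 𝔹, tentWeight d y := by
  rw [integral_pos_iff_support_of_nonneg_ae]
  · rw [Measure.restrict_apply₀' measurableSet_ball.nullMeasurableSet]
    have : Function.support (tentWeight d) ∩ 𝔹 = 𝔹 := by
      apply Set.inter_eq_right.2
      intro x hx
      exact (tent_pos hx).ne'
    rw [this]
    exact Metric.measure_ball_pos _ _ (by norm_num)
  · exact (ae_restrict_iff' measurableSet_ball).2
      (Filter.Eventually.of_forall fun x hx => (tent_pos hx).le)
  · exact tent_int

/-- radii of the dyadic exhaustion -/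
noncomputable def rad (k : ℕ) : ℝ := 3 / 2 - (1 / 2) ^ (k + 1)

lemma rad_le (k : ℕ) : rad k ≤ 3 / 2 := by
  unfold rad
  have : (0 : ℝ) < (1 / 2) ^ (k + 1) := by positivity
  linarith

lemma rad_pos (k : ℕ) : 0 < rad k := by
  unfold rad
  have : (1 / 2 : ℝ) ^ (k + 1) ≤ 1 := pow_le_one₀ (by norm_num) (by norm_num)
  linarith

/-- the `k`-th layer of the pair density -/
noncomputable def layer (v : 𝔼 → ℝ) (k : ℕ) (x y : 𝔼) : ℝ≥0∞ :=
  ENNReal.ofReal ((1 / 2 : ℝ) ^ (k + 1)) * gf (Metric.ball 0 (rad k)) v x y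

lemma tsum_layer (v : 𝔼 → ℝ) (x y : 𝔼) :
    ∑' k, layer v k x y =
      S (min (3 / 2 - ‖x‖) (3 / 2 - ‖y‖)) * ENNReal.ofReal ((v x - v y) ^ 2) := by
  unfold S
  rw [← ENNReal.tsum_mul_right]
  congr 1
  ext k
  unfold layer gf rad
  simp only [Set.indicator, Set.mem_prod, Metric.mem_ball, dist_zero_right, lt_min_iff]
  have : (‖x‖ < 3 / 2 - (1 / 2 : ℝ) ^ (k + 1) ∧ ‖y‖ < 3 / 2 - (1 / 2 : ℝ) ^ (k + 1)) ↔
      ((1 / 2 : ℝ) ^ (k + 1) < 3 / 2 - ‖x‖ ∧ (1 / 2 : ℝ) ^ (k + 1) < 3 / 2 - ‖y‖) := by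
    constructor <;> rintro ⟨h1, h2⟩ <;> constructor <;> linarith
  rw [if_congr this rfl rfl]
  split_ifs <;> simp

lemma min_tent (x y : 𝔼) : min (tentWeight d x) (tentWeight d y) =
    min (min (3 / 2 - ‖x‖) (3 / 2 - ‖y‖)) 1 := by
  unfold tentWeight
  rw [min_min_min_comm, min_self]

lemma upper (v : 𝔼 → ℝ) (x y : 𝔼) :
    ENNReal.ofReal ((v x - v y) ^ 2 * min (tentWeight d x) (tentWeight d y)) ≤
      ∑' k, layer v k x y := by
  rw [tsum_layer, min_tent, ENNReal.ofReal_mul (sq_nonneg _), mul_comm]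
  gcongr
  exact le_S _

lemma lower (v : 𝔼 → ℝ) (x y : 𝔼) : ∑' k, layer v k x y ≤ ENNReal.ofReal 2 *
    (𝔹).indicator (fun x => (𝔹).indicator (fun y => ENNReal.ofReal ((v x - v y) ^ 2 *
      min (tentWeight d x) (tentWeight d y))) y) x := by
  by_cases h : x ∈ 𝔹 ∧ y ∈ 𝔹
  · rw [Set.indicator_of_mem h.1, Set.indicator_of_mem h.2, tsum_layer, min_tent,
      ENNReal.ofReal_mul (sq_nonneg _), mul_left_comm, mul_comm]
    gcongr
    exact S_le _
  · have : ∀ k, layer v k x y = 0 := by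
      intro k
      unfold layer gf
      rw [Set.indicator_of_notMem, mul_zero]
      rintro ⟨h1, h2⟩
      exact h ⟨Metric.ball_subset_ball (rad_le k) h1, Metric.ball_subset_ball (rad_le k) h2⟩
    simp [this]

end main
end WP

theorem weighted_poincare (d : ℕ) (hd : 1 ≤ d) (α₀ Λ : ℝ) (hα₀ : 0 < α₀) (hΛ : 1 ≤ Λ) :
    ∃ c₂ : ℝ, 0 < c₂ ∧
      ∀ (α : ℝ), α₀ < α → α < 2 →
      ∀ (μ : EuclideanSpace ℝ (Fin d) → Measure (EuclideanSpace ℝ (Fin d))),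
        CondK1 d α Λ μ → CondK2 d α Λ μ →
        ∀ v : EuclideanSpace ℝ (Fin d) → ℝ, Measurable v →
          IntegrableOn (fun x => v x * tentWeight d x)
            (Metric.ball (0 : EuclideanSpace ℝ (Fin d)) (3 / 2)) →
          (∫⁻ x in Metric.ball (0 : EuclideanSpace ℝ (Fin d)) (3 / 2),
              ENNReal.ofReal
                ((v x - (∫ y in Metric.ball (0 : EuclideanSpace ℝ (Fin d)) (3 / 2),
                    tentWeight d y)⁻¹ *
                  ∫ y in Metric.ball (0 : EuclideanSpace ℝ (Fin d)) (3 / 2),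
                    v y * tentWeight d y) ^ 2 * tentWeight d x))
            ≤ ENNReal.ofReal c₂ *
              ∫⁻ x in Metric.ball (0 : EuclideanSpace ℝ (Fin d)) (3 / 2),
                ∫⁻ y in Metric.ball (0 : EuclideanSpace ℝ (Fin d)) (3 / 2),
                  ENNReal.ofReal ((v x - v y) ^ 2 * min (tentWeight d x) (tentWeight d y))
                    ∂(μ x) := by
    classical
  set M := ∫ y in Metric.ball (0 : EuclideanSpace ℝ (Fin d)) (3 / 2), tentWeight d y with hM
  have hMpos : 0 < M := WP.tent_mass
  set l : ℝ := (3 : ℝ) ^ (-(d : ℝ) - 2) / 2 with hl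
  have hlpos : 0 < l := by positivity
  refine ⟨M⁻¹ * (l⁻¹ * Λ * 2), by positivity, ?_⟩
  intro α hα hα2 μ _ hK2 v hv hvi
  set V := ∫ y in Metric.ball (0 : EuclideanSpace ℝ (Fin d)) (3 / 2), v y * tentWeight d y
  set B := Metric.ball (0 : EuclideanSpace ℝ (Fin d)) (3 / 2) with hB
  have hBm : MeasurableSet B := measurableSet_ball
  have hgm : ∀ k : ℕ, Measurable fun p : EuclideanSpace ℝ (Fin d) × EuclideanSpace ℝ (Fin d) =>
      WP.layer v k p.1 p.2 := fun k => (WP.gf_meas measurableSet_ball hv).const_mul _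
  -- energy on each ball
  have hball : ∀ k : ℕ, ∫⁻ x, ∫⁻ y, WP.layer v k x y ≤
      ENNReal.ofReal (l⁻¹ * Λ) * ∫⁻ x, ∫⁻ y, WP.layer v k x y ∂(μ x) := by
    intro k
    have h1 := WP.robust (WP.rad_le k) (hα₀.trans hα) hα2 hd hv
    have h2 := (hK2 0 (WP.rad k) (WP.rad_pos k) v hv).2
    have h3 := h1.trans h2
    rw [WP.set_pair volume (fun _ => volume) measurableSet_ball,
      WP.set_pair volume μ measurableSet_ball] at h3
    have e1 : ∫⁻ x, ∫⁻ y, WP.layer v k x y = ENNReal.ofReal ((1 / 2 : ℝ) ^ (k + 1)) *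
        ∫⁻ x, ∫⁻ y, WP.gf (Metric.ball 0 (WP.rad k)) v x y := by
      unfold WP.layer
      simp_rw [lintegral_const_mul' _ _ ENNReal.ofReal_ne_top]
    have e2 : ∫⁻ x, ∫⁻ y, WP.layer v k x y ∂(μ x) = ENNReal.ofReal ((1 / 2 : ℝ) ^ (k + 1)) *
        ∫⁻ x, ∫⁻ y, WP.gf (Metric.ball 0 (WP.rad k)) v x y ∂(μ x) := by
      unfold WP.layer
      simp_rw [lintegral_const_mul' _ _ ENNReal.ofReal_ne_top]
    have h4 : ∫⁻ x, ∫⁻ y, WP.gf (Metric.ball 0 (WP.rad k)) v x y ≤ ENNReal.ofReal (l⁻¹ * Λ) *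
        ∫⁻ x, ∫⁻ y, WP.gf (Metric.ball 0 (WP.rad k)) v x y ∂(μ x) := by
      calc _ = ENNReal.ofReal l⁻¹ * (ENNReal.ofReal l *
            ∫⁻ x, ∫⁻ y, WP.gf (Metric.ball 0 (WP.rad k)) v x y) := by
            rw [← mul_assoc, ← ENNReal.ofReal_mul (by positivity), inv_mul_cancel₀ hlpos.ne']
            simp
        _ ≤ ENNReal.ofReal l⁻¹ * (ENNReal.ofReal Λ *
            ∫⁻ x, ∫⁻ y, WP.gf (Metric.ball 0 (WP.rad k)) v x y ∂(μ x)) := by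
            exact mul_le_mul_right h3 _
        _ = _ := by rw [← mul_assoc, ← ENNReal.ofReal_mul (by positivity)]
    rw [e1, e2, mul_left_comm]
    gcongr
  calc _ ≤ ∫⁻ x in B, ENNReal.ofReal M⁻¹ * ∫⁻ y in B,
          ENNReal.ofReal ((v x - v y) ^ 2 * min (tentWeight d x) (tentWeight d y)) := by
        apply setLIntegral_mono' hBm
        intro x hx
        have hpx := WP.tent_pos hx
        rw [ENNReal.ofReal_mul (sq_nonneg _)]
        have hj := WP.jensen (ν := volume.restrict B) (v := v) WP.tent_int
          ((ae_restrict_iff' hBm).2 (Filter.Eventually.of_forall fun x hx => (WP.tent_pos hx).le))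
          hMpos hvi (v x)
        refine (mul_le_mul_left hj _).trans ?_
        rw [mul_assoc]
        refine mul_le_mul_right ?_ _
        rw [← lintegral_mul_const' _ _ ENNReal.ofReal_ne_top]
        apply setLIntegral_mono' hBm
        intro y hy
        have hpy := WP.tent_pos hy
        rw [← ENNReal.ofReal_mul (by positivity)]
        apply ENNReal.ofReal_le_ofReal
        rw [mul_assoc]
        refine mul_le_mul_of_nonneg_left ?_ (sq_nonneg _)
        have a1 : tentWeight d x ≤ 1 := min_le_right _ _
        have a2 : tentWeight d y ≤ 1 := min_le_right _ _
        apply le_min <;> nlinarith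
    _ = ENNReal.ofReal M⁻¹ * ∫⁻ x in B, ∫⁻ y in B,
          ENNReal.ofReal ((v x - v y) ^ 2 * min (tentWeight d x) (tentWeight d y)) :=
        lintegral_const_mul' _ _ ENNReal.ofReal_ne_top
    _ ≤ ENNReal.ofReal M⁻¹ * ∫⁻ x, ∫⁻ y, ∑' k, WP.layer v k x y := by
        refine mul_le_mul_right ?_ _
        refine (setLIntegral_le_lintegral _ _).trans (lintegral_mono fun x => ?_)
        exact (setLIntegral_le_lintegral _ _).trans (lintegral_mono fun y => WP.upper v x y)
    _ = ENNReal.ofReal M⁻¹ * ∑' k, ∫⁻ x, ∫⁻ y, WP.layer v k x y := by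
        congr 1
        rw [← lintegral_tsum fun k => (hgm k).lintegral_prod_right'.aemeasurable]
        congr 1
        ext x
        exact lintegral_tsum fun k => ((hgm k).comp measurable_prodMk_left).aemeasurable
    _ ≤ ENNReal.ofReal M⁻¹ * ∑' k, ENNReal.ofReal (l⁻¹ * Λ) *
          ∫⁻ x, ∫⁻ y, WP.layer v k x y ∂(μ x) :=
        mul_le_mul_right (ENNReal.tsum_le_tsum hball) _
    _ = ENNReal.ofReal M⁻¹ * (ENNReal.ofReal (l⁻¹ * Λ) *
          ∑' k, ∫⁻ x, ∫⁻ y, WP.layer v k x y ∂(μ x)) := by rw [ENNReal.tsum_mul_left]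
    _ ≤ ENNReal.ofReal M⁻¹ * (ENNReal.ofReal (l⁻¹ * Λ) *
          (ENNReal.ofReal 2 * ∫⁻ x in B, ∫⁻ y in B, ENNReal.ofReal ((v x - v y) ^ 2 *
            min (tentWeight d x) (tentWeight d y)) ∂(μ x))) := by
        refine mul_le_mul_right (mul_le_mul_right ?_ _) _
        refine (WP.tsum_lintegral_le _ _).trans ?_
        rw [← lintegral_const_mul' _ _ ENNReal.ofReal_ne_top, ← lintegral_indicator hBm]
        refine lintegral_mono fun x => ?_
        refine (WP.tsum_lintegral_le _ _).trans ?_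
        refine (lintegral_mono fun y => WP.lower v x y).trans ?_
        rw [lintegral_const_mul' _ _ ENNReal.ofReal_ne_top]
        by_cases hx : x ∈ B
        · rw [Set.indicator_of_mem hx, ← lintegral_indicator hBm]
          simp [← hB, hx]
        · simp [← hB, hx]
    _ = _ := by
        rw [ENNReal.ofReal_mul (p := M⁻¹) (by positivity), ENNReal.ofReal_mul (p := l⁻¹ * Λ) (q := 2) (by positivity)]
        ring
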